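/- Let p ∈ [0,1] and let K₀ = √((1+3p)/4)·I₂, K₁ = √((1−p)/4)·σx, K₂ = √((1−p)/4)·σy, K₃ = √((1−p)/4)·σz be the Kraus operators of the qubit depolarizing channel. Set ρ' = Σᵢ₌₀³ (Kᵢ⊗I₂)·ρ_AB·(Kᵢ⊗I₂)†. Then tr[ρ'·𝔅] = 4√3·p, and consequently tr[ρ'·𝔅] ≤ 4 holds if and only if p ≤ 1/√3. -/

import Mathlib

open Matrix Kronecker
open scoped ComplexOrder

noncomputable def σx : Matrix (Fin 2) (Fin 2) ℂ := !![0, 1; 1, 0]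
noncomputable def σy : Matrix (Fin 2) (Fin 2) ℂ := !![0, -Complex.I; Complex.I, 0]
noncomputable def σz : Matrix (Fin 2) (Fin 2) ℂ := !![1, 0; 0, -1]

/-- Bob's observables for the Elegant Bell inequality. -/
noncomputable def B1 : Matrix (Fin 2) (Fin 2) ℂ := (Real.sqrt 3 : ℂ)⁻¹ • (σx - σy + σz)
noncomputable def B2 : Matrix (Fin 2) (Fin 2) ℂ := (Real.sqrt 3 : ℂ)⁻¹ • (σx + σy - σz)
noncomputable def B3 : Matrix (Fin 2) (Fin 2) ℂ := (Real.sqrt 3 : ℂ)⁻¹ • (-σx - σy - σz)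
noncomputable def B4 : Matrix (Fin 2) (Fin 2) ℂ := (Real.sqrt 3 : ℂ)⁻¹ • (-σx + σy + σz)

/-- The EBI Bell operator 𝔅 with Alice's observables A₁ = σx, A₂ = σy, A₃ = σz. -/
noncomputable def EBIop : Matrix (Fin 2 × Fin 2) (Fin 2 × Fin 2) ℂ :=
  σx ⊗ₖ (B1 + B2 - B3 - B4) + σy ⊗ₖ (B1 - B2 + B3 - B4) + σz ⊗ₖ (B1 - B2 - B3 + B4)

/-- The maximally entangled two-qubit state. -/
noncomputable def ρAB : Matrix (Fin 2 × Fin 2) (Fin 2 × Fin 2) ℂ :=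
  (4 : ℂ)⁻¹ • ((1 : Matrix (Fin 2) (Fin 2) ℂ) ⊗ₖ (1 : Matrix (Fin 2) (Fin 2) ℂ)
    + σx ⊗ₖ σx - σy ⊗ₖ σy + σz ⊗ₖ σz)

/-- Kraus operators of the qubit depolarizing channel with parameter `p`. -/
noncomputable def depolK (p : ℝ) : Fin 4 → Matrix (Fin 2) (Fin 2) ℂ :=
  ![(Real.sqrt ((1 + 3 * p) / 4) : ℂ) • (1 : Matrix (Fin 2) (Fin 2) ℂ),
    (Real.sqrt ((1 - p) / 4) : ℂ) • σx,
    (Real.sqrt ((1 - p) / 4) : ℂ) • σy,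
    (Real.sqrt ((1 - p) / 4) : ℂ) • σz]

/-- In the EBI operator the combinations of Bob's observables collapse to Pauli matrices. -/
lemma EBIop_eq : EBIop =
    (4 * (Real.sqrt 3 : ℂ)⁻¹) • (σx ⊗ₖ σx - σy ⊗ₖ σy + σz ⊗ₖ σz) := by
  have hx : B1 + B2 - B3 - B4 = (4 * (Real.sqrt 3 : ℂ)⁻¹) • σx := by
    simp only [B1, B2, B3, B4]; module
  have hy : B1 - B2 + B3 - B4 = -((4 * (Real.sqrt 3 : ℂ)⁻¹) • σy) := by
    simp only [B1, B2, B3, B4]; module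
  have hz : B1 - B2 - B3 + B4 = (4 * (Real.sqrt 3 : ℂ)⁻¹) • σz := by
    simp only [B1, B2, B3, B4]; module
  rw [EBIop, hx, hy, hz, ← neg_smul]
  simp only [kronecker_smul]
  module

/-- The unnormalized EBI value after acting with `K` on the first qubit is a quadratic form in
the entries of `K`. -/
lemma trace_conj_ρAB_mul_EBIop (K : Matrix (Fin 2) (Fin 2) ℂ) :
    (((K ⊗ₖ (1 : Matrix (Fin 2) (Fin 2) ℂ)) * ρAB
        * (K ⊗ₖ (1 : Matrix (Fin 2) (Fin 2) ℂ))ᴴ) * EBIop).trace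
      = 2 * (Real.sqrt 3 : ℂ)⁻¹ *
        (2 * ((K 0 0 + K 1 1) * star (K 0 0 + K 1 1))
          - (K 0 0 * star (K 0 0) + K 0 1 * star (K 0 1)
            + K 1 0 * star (K 1 0) + K 1 1 * star (K 1 1))) := by
  rw [EBIop_eq]
  simp only [ρAB, σx, σy, σz, trace, diag_apply, mul_apply, Fintype.sum_prod_type,
    Fin.sum_univ_two, conjTranspose_apply, kroneckerMap_apply, Matrix.smul_apply, Matrix.add_apply, Matrix.sub_apply,
    smul_eq_mul, of_apply, cons_val', cons_val_zero, cons_val_one, cons_val_fin_one, one_apply]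
  simp
  ring

/-- Applying the depolarizing channel to the first qubit of the maximally entangled
state gives EBI value `4√3·p`, which is below the noncontextual bound `4`
exactly when `p ≤ 1/√3`. -/
theorem depol_first_qubit_EBI_value (p : ℝ) (hp0 : 0 ≤ p) (hp1 : p ≤ 1) :
    ((∑ i : Fin 4, (depolK p i ⊗ₖ (1 : Matrix (Fin 2) (Fin 2) ℂ)) * ρAB
        * (depolK p i ⊗ₖ (1 : Matrix (Fin 2) (Fin 2) ℂ))ᴴ) * EBIop).trace
      = ((4 * Real.sqrt 3 * p : ℝ) : ℂ) ∧
    (((∑ i : Fin 4, (depolK p i ⊗ₖ (1 : Matrix (Fin 2) (Fin 2) ℂ)) * ρAB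
        * (depolK p i ⊗ₖ (1 : Matrix (Fin 2) (Fin 2) ℂ))ᴴ) * EBIop).trace ≤ (4 : ℂ)
      ↔ p ≤ (Real.sqrt 3)⁻¹) := by
  have hsq : (Real.sqrt ((1 + 3 * p) / 4) : ℂ) * (Real.sqrt ((1 + 3 * p) / 4) : ℂ)
      = (1 + 3 * p) / 4 := by
    exact_mod_cast Real.mul_self_sqrt (by linarith : 0 ≤ (1 + 3 * p) / 4)
  have hsq' : (Real.sqrt ((1 - p) / 4) : ℂ) * (Real.sqrt ((1 - p) / 4) : ℂ)
      = (1 - p) / 4 := by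
    exact_mod_cast Real.mul_self_sqrt (by linarith : 0 ≤ (1 - p) / 4)
  have h3 : (Real.sqrt 3 : ℂ) * (Real.sqrt 3 : ℂ) = 3 := by
    exact_mod_cast Real.mul_self_sqrt (by norm_num : (0 : ℝ) ≤ 3)
  have hpos : 0 < Real.sqrt 3 := Real.sqrt_pos.mpr (by norm_num)
  have hval : ((∑ i : Fin 4, (depolK p i ⊗ₖ (1 : Matrix (Fin 2) (Fin 2) ℂ)) * ρAB
        * (depolK p i ⊗ₖ (1 : Matrix (Fin 2) (Fin 2) ℂ))ᴴ) * EBIop).trace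
      = ((4 * Real.sqrt 3 * p : ℝ) : ℂ) := by
    have hinv : (Real.sqrt 3 : ℂ)⁻¹ = (Real.sqrt 3 : ℂ) / 3 := by
      rw [← h3]; field_simp
    rw [Finset.sum_mul, trace_sum]
    simp only [trace_conj_ρAB_mul_EBIop, hinv, Fin.sum_univ_four, depolK, σx, σy, σz]
    generalize Real.sqrt ((1 + 3 * p) / 4) = a at *
    generalize Real.sqrt ((1 - p) / 4) = b at *
    simp
    linear_combination (4 * (Real.sqrt 3 : ℂ)) * hsq - (4 * (Real.sqrt 3 : ℂ)) * hsq'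
      + (4 / 3 * (Real.sqrt 3 : ℂ) * b ^ 2) * Complex.I_sq
  refine ⟨hval, ?_⟩
  rw [hval, show (4 : ℂ) = ((4 : ℝ) : ℂ) by norm_num, Complex.real_le_real,
    ← one_div, le_div_iff₀ hpos]
  constructor <;> intro h <;> linarith
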